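/- Let a, b ∈ ℝ with a ≠ 0, and for y ≠ 0 define G(y) = ½Φ(y) + ½Φ(a/√(1+b²)) − ½·1{ a/(y√(1+b²)) < 0 } − T(y, (a + b y)/y) − T(a/√(1+b²), (ab + y(1+b²))/a). Then G(y) → Φ(a/√(1+b²)) as y → +∞, where T is Owen's T function. (Consequently, with a = μ√(σ_v²+σ_u²)/(σ_v σ_u) and b = −σ_u/σ_v one has a/√(1+b²) = μ/σ_u, so the truncated-normal composed error cdf tends to 1.) -/

import Mathlib

open Real MeasureTheory Filter Topology

/-- Standard normal density. -/
noncomputable def stdNormalPdf (x : ℝ) : ℝ := Real.exp (-x ^ 2 / 2) / Real.sqrt (2 * Real.pi)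

/-- Standard normal cumulative distribution function. -/
noncomputable def stdNormalCdf (x : ℝ) : ℝ := ∫ t in Set.Iic x, stdNormalPdf t

/-- Owen's T function. -/
noncomputable def owenT (h g : ℝ) : ℝ :=
  (1 / (2 * Real.pi)) * ∫ t in (0:ℝ)..g, Real.exp (-h ^ 2 * (1 + t ^ 2) / 2) / (1 + t ^ 2)


lemma stdNormalPdf_eq_gaussianPDFReal : stdNormalPdf = ProbabilityTheory.gaussianPDFReal 0 1 := by
  ext x
  simp [stdNormalPdf, ProbabilityTheory.gaussianPDFReal, div_eq_inv_mul]

lemma integrable_stdNormalPdf : Integrable stdNormalPdf := by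
  rw [stdNormalPdf_eq_gaussianPDFReal]
  exact ProbabilityTheory.integrable_gaussianPDFReal 0 1

lemma integral_stdNormalPdf : ∫ x, stdNormalPdf x = 1 := by
  rw [stdNormalPdf_eq_gaussianPDFReal]
  exact ProbabilityTheory.integral_gaussianPDFReal_eq_one 0 one_ne_zero

lemma stdNormalCdf_add_integral_Ioi (x : ℝ) :
    stdNormalCdf x + ∫ t in Set.Ioi x, stdNormalPdf t = 1 := by
  rw [stdNormalCdf, ← Set.compl_Iic, integral_add_compl measurableSet_Iic integrable_stdNormalPdf,
    integral_stdNormalPdf]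

lemma stdNormalCdf_neg (x : ℝ) : stdNormalCdf (-x) = 1 - stdNormalCdf x := by
  have h : stdNormalCdf (-x) = ∫ t in Set.Ioi x, stdNormalPdf t := by
    have := integral_comp_neg_Iic (-x) stdNormalPdf
    simpa [stdNormalPdf, stdNormalCdf] using this
  linarith [stdNormalCdf_add_integral_Ioi x]

lemma tendsto_stdNormalCdf_atTop : Tendsto stdNormalCdf atTop (𝓝 1) := by
  rw [← integral_stdNormalPdf]
  exact (aecover_Iic tendsto_id).integral_tendsto_of_countably_generated integrable_stdNormalPdf

lemma owenT_neg_left (h g : ℝ) : owenT (-h) g = owenT h g := by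
  simp [owenT]

lemma owenT_neg_right (h g : ℝ) : owenT h (-g) = -owenT h g := by
  have := intervalIntegral.integral_comp_neg (a := 0) (b := g)
    (fun t : ℝ => Real.exp (-h ^ 2 * (1 + t ^ 2) / 2) / (1 + t ^ 2))
  simp only [even_two.neg_pow, neg_zero] at this
  rw [owenT, owenT, intervalIntegral.integral_symm, ← this, mul_neg]

lemma owenT_integrand_le (h t : ℝ) :
    Real.exp (-h ^ 2 * (1 + t ^ 2) / 2) / (1 + t ^ 2) ≤
      Real.exp (-h ^ 2 / 2) * (1 + t ^ 2)⁻¹ := by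
  rw [div_eq_mul_inv]
  gcongr
  nlinarith [mul_nonneg (sq_nonneg h) (sq_nonneg t)]

lemma integrable_owenT_integrand (h : ℝ) :
    Integrable fun t : ℝ => Real.exp (-h ^ 2 * (1 + t ^ 2) / 2) / (1 + t ^ 2) := by
  refine (integrable_inv_one_add_sq.const_mul (Real.exp (-h ^ 2 / 2))).mono'
    (Continuous.aestronglyMeasurable ?_) (ae_of_all _ fun t => ?_)
  · exact Continuous.div (by fun_prop) (by fun_prop) fun t => by positivity
  · rw [Real.norm_of_nonneg (by positivity)]
    exact owenT_integrand_le h t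

lemma abs_owenT_le (h g : ℝ) : |owenT h g| ≤ Real.exp (-h ^ 2 / 2) * |g| := by
  have hint : ‖∫ t in (0:ℝ)..g, Real.exp (-h ^ 2 * (1 + t ^ 2) / 2) / (1 + t ^ 2)‖ ≤
      Real.exp (-h ^ 2 / 2) * |g - 0| := by
    refine intervalIntegral.norm_integral_le_of_norm_le_const fun t _ => ?_
    rw [Real.norm_of_nonneg (by positivity)]
    refine (owenT_integrand_le h t).trans (mul_le_of_le_one_right (by positivity) ?_)
    exact inv_le_one_of_one_le₀ (by nlinarith)
  rw [sub_zero, Real.norm_eq_abs] at hint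
  rw [owenT, abs_mul]
  refine (mul_le_of_le_one_left (abs_nonneg _) ?_).trans hint
  rw [abs_of_pos (by positivity), div_le_one (by positivity)]
  linarith [Real.pi_gt_three]

lemma tendsto_exp_neg_sq_div_two_atTop :
    Tendsto (fun x : ℝ => Real.exp (-x ^ 2 / 2)) atTop (𝓝 0) := by
  refine Real.tendsto_exp_atBot.comp ?_
  simp only [neg_div]
  exact tendsto_neg_atTop_atBot.comp ((tendsto_pow_atTop two_ne_zero).atTop_div_const two_pos)

lemma tendsto_integral_owenT_integrand_atTop :
    Tendsto (fun h : ℝ => ∫ t in Set.Ioi (0:ℝ), Real.exp (-h ^ 2 * (1 + t ^ 2) / 2) / (1 + t ^ 2))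
      atTop (𝓝 0) := by
  have hlim := tendsto_exp_neg_sq_div_two_atTop.mul_const (∫ t in Set.Ioi (0:ℝ), (1 + t ^ 2)⁻¹)
  rw [zero_mul] at hlim
  refine squeeze_zero (fun h => integral_nonneg fun t => by positivity) (fun h => ?_) hlim
  rw [← integral_const_mul]
  exact integral_mono (integrable_owenT_integrand h).integrableOn
    (integrable_inv_one_add_sq.integrableOn.const_mul _) (owenT_integrand_le h)

lemma hasDerivAt_integral_owenT_integrand {h : ℝ} (hh : 0 < h) :
    HasDerivAt
      (fun x : ℝ => ∫ t in Set.Ioi (0:ℝ), Real.exp (-x ^ 2 * (1 + t ^ 2) / 2) / (1 + t ^ 2))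
      (-π * stdNormalPdf h) h := by
  have hbound (t x : ℝ) (hx : x ∈ Set.Ioo (h / 2) (2 * h)) :
      ‖-x * Real.exp (-x ^ 2 * (1 + t ^ 2) / 2)‖ ≤
        2 * h * Real.exp (-(h ^ 2 / 8) * t ^ 2) := by
    obtain ⟨hx1, hx2⟩ := hx
    have hx0 : 0 < x := by linarith
    rw [norm_mul, norm_neg, Real.norm_of_nonneg hx0.le, Real.norm_of_nonneg (Real.exp_nonneg _)]
    have hsq : h ^ 2 / 4 ≤ x ^ 2 := by nlinarith
    gcongr
    nlinarith [mul_le_mul_of_nonneg_right hsq (sq_nonneg t), sq_nonneg x]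
  have hdiff (t x : ℝ) :
      HasDerivAt (fun x : ℝ => Real.exp (-x ^ 2 * (1 + t ^ 2) / 2) / (1 + t ^ 2))
        (-x * Real.exp (-x ^ 2 * (1 + t ^ 2) / 2)) x := by
    have hexp : HasDerivAt (fun x : ℝ => -x ^ 2 * (1 + t ^ 2) / 2) (-x * (1 + t ^ 2)) x := by
      refine (((hasDerivAt_pow 2 x).neg.mul_const (1 + t ^ 2)).div_const 2).congr_deriv ?_
      norm_num
      ring
    refine (hexp.exp.div_const (1 + t ^ 2)).congr_deriv ?_
    have : (1 + t ^ 2 : ℝ) ≠ 0 := by positivity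
    field_simp
  have hderiv := (hasDerivAt_integral_of_dominated_loc_of_deriv_le
    (μ := volume.restrict (Set.Ioi (0:ℝ)))
    (F := fun x t : ℝ => Real.exp (-x ^ 2 * (1 + t ^ 2) / 2) / (1 + t ^ 2))
    (F' := fun x t : ℝ => -x * Real.exp (-x ^ 2 * (1 + t ^ 2) / 2))
    (bound := fun t : ℝ => 2 * h * Real.exp (-(h ^ 2 / 8) * t ^ 2))
    (Ioo_mem_nhds (half_lt_self hh) (by linarith : h < 2 * h))
    (Eventually.of_forall fun x => (integrable_owenT_integrand x).integrableOn.1)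
    (integrable_owenT_integrand h).integrableOn
    (Continuous.aestronglyMeasurable (by fun_prop))
    (ae_of_all _ hbound)
    ((integrable_exp_neg_mul_sq (by positivity)).integrableOn.const_mul _)
    (ae_of_all _ fun t x _ => hdiff t x)).2
  refine hderiv.congr_deriv ?_
  have hsplit (t : ℝ) : -h * Real.exp (-h ^ 2 * (1 + t ^ 2) / 2) =
      -h * Real.exp (-h ^ 2 / 2) * Real.exp (-(h ^ 2 / 2) * t ^ 2) := by
    rw [mul_assoc, ← Real.exp_add]
    ring_nf
  simp_rw [hsplit]
  rw [integral_const_mul, integral_gaussian_Ioi, stdNormalPdf,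
    show π / (h ^ 2 / 2) = 2 * π / h ^ 2 by field_simp, Real.sqrt_div (by positivity),
    Real.sqrt_sq hh.le]
  have hsq : √(2 * π) ^ 2 = 2 * π := Real.sq_sqrt (by positivity)
  field_simp
  rw [hsq]

lemma integral_owenT_integrand {h : ℝ} (hh : 0 < h) :
    ∫ t in Set.Ioi (0:ℝ), Real.exp (-h ^ 2 * (1 + t ^ 2) / 2) / (1 + t ^ 2) =
      π * (1 - stdNormalCdf h) := by
  have := integral_Ioi_of_hasDerivAt_of_tendsto'
    (fun x (hx : h ≤ x) => hasDerivAt_integral_owenT_integrand (hh.trans_le hx))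
    (integrable_stdNormalPdf.integrableOn.const_mul _) tendsto_integral_owenT_integrand_atTop
  rw [integral_const_mul] at this
  rw [show 1 - stdNormalCdf h = ∫ t in Set.Ioi h, stdNormalPdf t by
    linarith [stdNormalCdf_add_integral_Ioi h]]
  linarith

lemma tendsto_owenT_atTop {h : ℝ} (hh : 0 < h) :
    Tendsto (owenT h) atTop (𝓝 ((1 - stdNormalCdf h) / 2)) := by
  have := (intervalIntegral_tendsto_integral_Ioi 0
    (integrable_owenT_integrand h).integrableOn tendsto_id).const_mul (1 / (2 * π))
  rw [integral_owenT_integrand hh] at this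
  rwa [show 1 / (2 * π) * (π * (1 - stdNormalCdf h)) = (1 - stdNormalCdf h) / 2 by field_simp]
    at this

lemma tendsto_owenT_atBot {h : ℝ} (hh : h < 0) :
    Tendsto (owenT h) atBot (𝓝 (-stdNormalCdf h / 2)) := by
  have := ((tendsto_owenT_atTop (neg_pos.mpr hh)).comp tendsto_neg_atBot_atTop).neg
  rw [stdNormalCdf_neg] at this
  convert this using 2
  · simp [owenT_neg_left, owenT_neg_right]
  · ring

lemma tendsto_owenT_self_div (a b : ℝ) :
    Tendsto (fun y => owenT y ((a + b * y) / y)) atTop (𝓝 0) := by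
  have hslope : Tendsto (fun y : ℝ => a / y + b) atTop (𝓝 (0 + b)) :=
    (tendsto_id.const_div_atTop a).add_const b
  have hbound := tendsto_exp_neg_sq_div_two_atTop.mul hslope.abs
  rw [zero_mul] at hbound
  refine squeeze_zero_norm' ?_ hbound
  filter_upwards [eventually_gt_atTop 0] with y hy
  rw [show a / y + b = (a + b * y) / y by field_simp]
  exact abs_owenT_le _ _

theorem stmt14 (a b : ℝ) (ha : a ≠ 0)
    (G : ℝ → ℝ)
    (hG : ∀ y : ℝ, y ≠ 0 → G y =
      (1 / 2) * stdNormalCdf y + (1 / 2) * stdNormalCdf (a / Real.sqrt (1 + b ^ 2))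
        - (1 / 2) * (if a / (y * Real.sqrt (1 + b ^ 2)) < 0 then 1 else 0)
        - owenT y ((a + b * y) / y)
        - owenT (a / Real.sqrt (1 + b ^ 2)) ((a * b + y * (1 + b ^ 2)) / a)) :
    Tendsto G atTop (𝓝 (stdNormalCdf (a / Real.sqrt (1 + b ^ 2)))) := by
  have hs : 0 < Real.sqrt (1 + b ^ 2) := Real.sqrt_pos.mpr (by positivity)
  set c := a / Real.sqrt (1 + b ^ 2) with hc
  have hnum : Tendsto (fun y : ℝ => a * b + y * (1 + b ^ 2)) atTop atTop :=
    tendsto_atTop_add_const_left _ _ (tendsto_id.atTop_mul_const (by positivity))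
  have hfirst := ((tendsto_stdNormalCdf_atTop.const_mul (1 / 2)).add_const
    (1 / 2 * stdNormalCdf c))
  rcases ha.lt_or_gt with ha | ha
  · have hT := (tendsto_owenT_atBot (div_neg_of_neg_of_pos ha hs)).comp
      (hnum.atTop_div_const_of_neg ha)
    have hlim := ((hfirst.sub_const (1 / 2 * 1)).sub (tendsto_owenT_self_div a b)).sub hT
    rw [← hc] at hlim
    convert hlim.congr' ?_ using 2
    · ring
    · filter_upwards [eventually_gt_atTop 0] with y hy
      rw [hG y hy.ne', if_pos (div_neg_of_neg_of_pos ha (by positivity))]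
      rfl
  · have hT := (tendsto_owenT_atTop (div_pos ha hs)).comp (hnum.atTop_div_const ha)
    have hlim := ((hfirst.sub_const (1 / 2 * 0)).sub (tendsto_owenT_self_div a b)).sub hT
    rw [← hc] at hlim
    convert hlim.congr' ?_ using 2
    · ring
    · filter_upwards [eventually_gt_atTop 0] with y hy
      rw [hG y hy.ne', if_neg (by positivity : (0:ℝ) ≤ a / (y * √(1 + b ^ 2))).not_gt]
      rfl
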